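/- In the fast diffusion setting below, there exists a constant C > 0, depending only on n, Ω, T, p, b, c₀ and ∫_Ω |∇u(x,0)|² dx, such that ∂_t u(x,t) ≤ C for all (x,t) ∈ closure(Ω) × [T/2, T]. -/

import Mathlib

open MeasureTheory Real Set

noncomputable section

/-- Partial derivative in the `i`-th coordinate direction. -/
def pderiv' {n : ℕ} (i : Fin n) (f : EuclideanSpace ℝ (Fin n) → ℝ)
    (x : EuclideanSpace ℝ (Fin n)) : ℝ :=
  fderiv ℝ f x (EuclideanSpace.single i 1)

/-- The Laplacian `Δf = ∑ᵢ ∂ᵢ∂ᵢ f`. -/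
def lap {n : ℕ} (f : EuclideanSpace ℝ (Fin n) → ℝ) (x : EuclideanSpace ℝ (Fin n)) : ℝ :=
  ∑ i, pderiv' i (pderiv' i f) x

/-- Distance to the boundary of `Ω`. -/
def dB {n : ℕ} (Ω : Set (EuclideanSpace ℝ (Fin n))) (x : EuclideanSpace ℝ (Fin n)) : ℝ :=
  Metric.infDist x (frontier Ω)

/-- A smooth bounded domain: a nonempty bounded open set which is the sublevel set
of a smooth defining function with nonvanishing gradient on the boundary. -/
def IsSmoothDomain {n : ℕ} (Ω : Set (EuclideanSpace ℝ (Fin n))) : Prop :=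
  IsOpen Ω ∧ Bornology.IsBounded Ω ∧ Ω.Nonempty ∧
    ∃ Φ : EuclideanSpace ℝ (Fin n) → ℝ, ContDiff ℝ (⊤ : ℕ∞) Φ ∧
      Ω = {x | Φ x < 0} ∧ frontier Ω = {x | Φ x = 0} ∧
      ∀ x ∈ frontier Ω, gradient Φ x ≠ 0

/-- A function on `Ω × [0,T]` extends continuously to `closure Ω × [0,T]`. -/
def ExtendsCont {n : ℕ} (Ω : Set (EuclideanSpace ℝ (Fin n))) (T : ℝ)
    (f : EuclideanSpace ℝ (Fin n) → ℝ → ℝ) : Prop :=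
  ∃ g : EuclideanSpace ℝ (Fin n) → ℝ → ℝ,
    ContinuousOn (fun z : EuclideanSpace ℝ (Fin n) × ℝ => g z.1 z.2)
      (closure Ω ×ˢ Set.Icc 0 T) ∧
    ∀ x ∈ Ω, ∀ t ∈ Set.Icc 0 T, g x t = f x t

/-- Membership in `C^{3,2}(closure Ω × [0,T])`, with the first and second time
derivatives recorded as the functions `ut` and `utt`:  `u`, `D_x u`, `D_x² u`,
`D_x³ u`, `∂ₜ u`, `D_x ∂ₜ u`, `D_x² ∂ₜ u`, `∂ₜ² u` all extend continuously to
`closure Ω × [0,T]`. -/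
def C32 {n : ℕ} (Ω : Set (EuclideanSpace ℝ (Fin n))) (T : ℝ)
    (u ut utt : EuclideanSpace ℝ (Fin n) → ℝ → ℝ) : Prop :=
  (∀ t ∈ Set.Icc (0 : ℝ) T, ContDiffOn ℝ 3 (fun x => u x t) Ω) ∧
  (∀ t ∈ Set.Icc (0 : ℝ) T, ContDiffOn ℝ 2 (fun x => ut x t) Ω) ∧
  (∀ x ∈ Ω, ∀ t ∈ Set.Icc (0 : ℝ) T, HasDerivWithinAt (u x) (ut x t) (Set.Icc 0 T) t) ∧
  (∀ x ∈ Ω, ∀ t ∈ Set.Icc (0 : ℝ) T, HasDerivWithinAt (ut x) (utt x t) (Set.Icc 0 T) t) ∧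
  ContinuousOn (fun z : EuclideanSpace ℝ (Fin n) × ℝ => u z.1 z.2)
    (closure Ω ×ˢ Set.Icc 0 T) ∧
  ContinuousOn (fun z : EuclideanSpace ℝ (Fin n) × ℝ => ut z.1 z.2)
    (closure Ω ×ˢ Set.Icc 0 T) ∧
  ContinuousOn (fun z : EuclideanSpace ℝ (Fin n) × ℝ => utt z.1 z.2)
    (closure Ω ×ˢ Set.Icc 0 T) ∧
  (∀ i : Fin n, ExtendsCont Ω T fun x t => pderiv' i (fun y => u y t) x) ∧
  (∀ i j : Fin n, ExtendsCont Ω T fun x t => pderiv' i (pderiv' j fun y => u y t) x) ∧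
  (∀ i j k : Fin n,
    ExtendsCont Ω T fun x t => pderiv' i (pderiv' j (pderiv' k fun y => u y t)) x) ∧
  (∀ i : Fin n, ExtendsCont Ω T fun x t => pderiv' i (fun y => ut y t) x) ∧
  (∀ i j : Fin n, ExtendsCont Ω T fun x t => pderiv' i (pderiv' j fun y => ut y t) x)

/-- The fast diffusion setting of Section 4 of the paper: `u ∈ C^{3,2}(closure Ω × [0,T])`
is positive in `Ω × [0,T]`, solves `∂ₜ(u^p) = Δu + bu + u^p` in `Ω × (0,T]`, vanishes
on `∂Ω × [0,T]`, and is comparable to the distance to the boundary. -/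
def FDSetting {n : ℕ} (Ω : Set (EuclideanSpace ℝ (Fin n))) (p b T c₀ : ℝ)
    (u ut utt : EuclideanSpace ℝ (Fin n) → ℝ → ℝ) : Prop :=
  IsSmoothDomain Ω ∧ 1 < p ∧ (n ≤ 2 ∨ p ≤ ((n : ℝ) + 2) / ((n : ℝ) - 2)) ∧
  0 < T ∧ 1 ≤ c₀ ∧
  C32 Ω T u ut utt ∧
  (∀ x ∈ Ω, ∀ t ∈ Set.Icc (0 : ℝ) T, 0 < u x t) ∧
  (∀ x ∈ Ω, ∀ t ∈ Set.Ioc (0 : ℝ) T,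
      HasDerivWithinAt (fun s => u x s ^ p)
        (lap (fun y => u y t) x + b * u x t + u x t ^ p) (Set.Icc 0 T) t) ∧
  (∀ x ∈ frontier Ω, ∀ t ∈ Set.Icc (0 : ℝ) T, u x t = 0) ∧
  (∀ x ∈ Ω, ∀ t ∈ Set.Icc (0 : ℝ) T,
      c₀⁻¹ * dB Ω x ≤ u x t ∧ u x t ≤ c₀ * dB Ω x)

/-- Second derivative test (necessary condition) at a local maximum. -/
theorem second_deriv_nonpos_of_isLocalMax {g g' : ℝ → ℝ} {g'' s : ℝ}
    (hg : ∀ᶠ r in nhds s, HasDerivAt g (g' r) r) (hg' : HasDerivAt g' g'' s)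
    (hmax : IsLocalMax g s) : g'' ≤ 0 := by
  by_contra! hpos
  have hd : deriv g =ᶠ[nhds s] g' := hg.mono fun r hr => hr.deriv
  have hdd : deriv (deriv g) s = g'' := (hg'.congr_of_eventuallyEq hd).deriv
  have hmin : IsLocalMin g s :=
    isLocalMin_of_deriv_deriv_pos (by rwa [hdd]) hmax.deriv_eq_zero hg.self_of_nhds.continuousAt
  have hconst : g =ᶠ[nhds s] fun _ => g s := by
    filter_upwards [hmin, hmax] with r h1 h2 using le_antisymm h2 h1
  have h0 : deriv g =ᶠ[nhds s] fun _ => (0 : ℝ) := by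
    filter_upwards [hconst.deriv] with r hr
    simpa using hr
  rw [h0.deriv_eq, deriv_const] at hdd
  exact hpos.ne hdd

/-- The derivative is nonnegative at a right endpoint maximum. -/
theorem deriv_nonneg_of_forall_le_left {g : ℝ → ℝ} {g' a b s : ℝ} (has : a < s) (hsb : s ≤ b)
    (hg : HasDerivWithinAt g g' (Icc a b) s) (hmax : ∀ r ∈ Ico a s, g r ≤ g s) : 0 ≤ g' := by
  have h1 : HasDerivWithinAt g g' (Ico a s) s :=
    hg.mono fun r hr => ⟨hr.1, hr.2.le.trans hsb⟩
  rw [hasDerivWithinAt_iff_tendsto_slope' (fun h => lt_irrefl _ h.2)] at h1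
  have : (nhdsWithin s (Ico a s)).NeBot := by
    rw [← mem_closure_iff_nhdsWithin_neBot, closure_Ico has.ne]
    exact ⟨has.le, le_rfl⟩
  refine ge_of_tendsto h1 ?_
  filter_upwards [self_mem_nhdsWithin] with r hr
  rw [slope_def_field]
  exact div_nonneg_of_nonpos (sub_nonpos.2 (hmax r hr)) (sub_nonpos.2 hr.2.le)

/-- Interchange of a time derivative and a derivative in a parameter. -/
theorem hasDerivWithinAt_param_deriv {F Fs Fsη : ℝ → ℝ → ℝ} {Fη : ℝ → ℝ} {r t : ℝ} {S : Set ℝ}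
    (hr : 0 < r) (hS : Convex ℝ S) (ht : t ∈ S)
    (h1 : ∀ η ∈ Metric.ball (0 : ℝ) r, ∀ s ∈ S, HasDerivWithinAt (F η) (Fs η s) S s)
    (h2 : ∀ s ∈ S, HasDerivAt (fun η => F η s) (Fη s) 0)
    (h3 : ∀ s ∈ S, ∀ η ∈ Metric.ball (0 : ℝ) r,
      HasDerivAt (fun η => Fs η s) (Fsη η s) η)
    (h4 : ContinuousWithinAt (fun q : ℝ × ℝ => Fsη q.1 q.2) (Metric.ball 0 r ×ˢ S) (0, t)) :
    HasDerivWithinAt Fη (Fsη 0 t) S t := by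
  rw [hasDerivWithinAt_iff_isLittleO, Asymptotics.isLittleO_iff]
  intro κ hκ
  obtain ⟨δ, hδ, hδ'⟩ := Metric.continuousWithinAt_iff.1 h4 κ hκ
  set ρ := min δ r
  have hρ : 0 < ρ := lt_min hδ hr
  have hclose : ∀ η ∈ Metric.ball (0 : ℝ) ρ, ∀ s ∈ S ∩ Metric.ball t δ,
      ‖Fsη η s - Fsη 0 t‖ ≤ κ := by
    intro η hη s hs
    refine (hδ' (x := (η, s))
      ⟨Metric.ball_subset_ball (min_le_right _ _) hη, hs.1⟩ ?_).le
    rw [Prod.dist_eq]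
    exact max_lt (Metric.ball_subset_ball (min_le_left _ _) hη) hs.2
  have hspace : ∀ η ∈ Metric.ball (0 : ℝ) ρ, ∀ s ∈ S ∩ Metric.ball t δ,
      ‖Fs η s - Fs 0 s - η * Fsη 0 t‖ ≤ κ * ‖η‖ := by
    intro η hη s hs
    have := (convex_ball (0 : ℝ) ρ).norm_image_sub_le_of_norm_hasDerivWithin_le
      (f := fun η => Fs η s - η * Fsη 0 t) (f' := fun η => Fsη η s - 1 * Fsη 0 t) (C := κ)
      (x := 0) (y := η)
      (fun ξ hξ => (((h3 s hs.1 ξ (Metric.ball_subset_ball (min_le_right _ _) hξ)).sub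
        ((hasDerivAt_id ξ).mul_const _))).hasDerivWithinAt)
      (fun ξ hξ => by rw [one_mul]; exact hclose ξ hξ s hs) (Metric.mem_ball_self hρ) hη
    calc _ = _ := by congr 1; ring
      _ ≤ _ := this
      _ = _ := by rw [sub_zero]
  have htime : ∀ η ∈ Metric.ball (0 : ℝ) ρ, ∀ s ∈ S ∩ Metric.ball t δ,
      ‖F η s - F η t - (F 0 s - F 0 t) - (s - t) * (η * Fsη 0 t)‖ ≤ κ * ‖η‖ * ‖s - t‖ := by
    intro η hη s hs
    have h0 : (0 : ℝ) ∈ Metric.ball (0 : ℝ) r := Metric.mem_ball_self hr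
    have hη' := Metric.ball_subset_ball (min_le_right δ r) hη
    have := (hS.inter (convex_ball t δ)).norm_image_sub_le_of_norm_hasDerivWithin_le
      (f := fun s => F η s - F 0 s - s * (η * Fsη 0 t))
      (f' := fun s => Fs η s - Fs 0 s - 1 * (η * Fsη 0 t)) (C := κ * ‖η‖)
      (x := t) (y := s)
      (fun ξ hξ => ((((h1 η hη' ξ hξ.1).sub (h1 0 h0 ξ hξ.1)).mono inter_subset_left).sub
        ((hasDerivWithinAt_id ξ _).mul_const _)))
      (fun ξ hξ => by rw [one_mul]; exact hspace η hη ξ hξ) ⟨ht, Metric.mem_ball_self hδ⟩ hs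
    calc _ = _ := by congr 1; ring
      _ ≤ _ := this
  filter_upwards [inter_mem_nhdsWithin S (Metric.ball_mem_nhds t hδ)] with s hs
  have hlim := ((((h2 s hs.1).sub (h2 t ht)).tendsto_slope_zero).sub_const
    ((s - t) * Fsη 0 t)).norm
  rw [smul_eq_mul]
  refine le_of_tendsto hlim ?_
  filter_upwards [self_mem_nhdsWithin,
    mem_nhdsWithin_of_mem_nhds (Metric.ball_mem_nhds (0 : ℝ) hρ)] with η hη0 hη
  have hη0 : η ≠ 0 := hη0
  have h := htime η hη s hs
  have hpos : 0 < ‖η‖ := norm_pos_iff.2 hη0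
  rw [← mul_le_mul_iff_of_pos_left hpos, ← norm_mul]
  calc _ = _ := by
        congr 1
        simp only [zero_add, smul_eq_mul, Pi.sub_apply]
        field_simp
    _ ≤ _ := h
    _ = _ := by ring

/-- Algebraic contradiction at a first touching point of the solution and the barrier. -/
theorem touching_point_algebra {p b t z u E A B K a Q lz lu zt N : ℝ} (hp : 1 < p) (ht : 0 < t)
    (hu : 0 < u) (hQ : 0 < Q) (hE : 0 < E) (hh : 0 < 1 + B * u - A * u ^ 2)
    (ha : a = t / p + 1 / (p - 1))
    (h1 : p * (Q * u) * z = lu + b * u + Q * u ^ 2)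
    (h2 : p * ((p - 1) * Q * z * z + Q * u * zt) = lz + b * z + p * (Q * u) * z)
    (htouch : t * z - a * u - E * (1 + B * u - A * u ^ 2) = 0)
    (hGt : 0 ≤ z + t * zt - u / p - a * z
      - E * (K * (1 + B * u - A * u ^ 2) + (B - 2 * A * u) * z))
    (hG : t * lz - a * lu - E * (B * lu - 2 * A * (N + u * lu)) ≤ 0)
    (hbar : b * (1 + A * u ^ 2) + Q * u * (1 + B * u - A * u ^ 2) * (1 - p * K)
      - (B - 2 * A * u) * (Q * u ^ 2) - 2 * A * N < 0) : False := by
  have hp1 : 0 < p - 1 := by linarith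
  have ha0 : 0 < a := by rw [ha]; positivity
  set h := 1 + B * u - A * u ^ 2 with hhdef
  have hz : 0 < z := by
    have : 0 < t * z := by have := mul_pos ha0 hu; have := mul_pos hE hh; linarith
    exact pos_of_mul_pos_right this ht.le
  have ha' : p * (p - 1) * a = (p - 1) * t + p := by rw [ha]; field_simp
  have hu' : p * (u / p) = u := by field_simp
  have key : p * (Q * u) * (z + t * zt - u / p - a * z - E * (K * h + (B - 2 * A * u) * z))
      - (t * lz - a * lu - E * (B * lu - 2 * A * (N + u * lu)))
      = E * (b * (1 + A * u ^ 2) + Q * u * h * (1 - p * K)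
      - (B - 2 * A * u) * (Q * u ^ 2) - 2 * A * N) - Q * u ^ 2 - p * (p - 1) * Q * z * E * h := by
    have hb : b * (1 + A * u ^ 2) = b * h - b * u * (B - 2 * A * u) := by rw [hhdef]; ring
    rw [hb]
    clear_value h
    linear_combination t * h2 - (a + E * (B - 2 * A * u)) * h1 - Q * u * hu' - Q * u * z * ha'
      + (b + Q * u - p * (p - 1) * Q * z) * htouch
  have e1 := mul_nonneg (mul_pos (by linarith : 0 < p) (mul_pos hQ hu)).le hGt
  have e2 := mul_neg_of_pos_of_neg hE hbar
  have e3 : 0 < p * (p - 1) * Q * z * E * h := by positivity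
  have e4 : 0 < Q * u ^ 2 := by positivity
  linarith

theorem hasDerivAt_comp_line {n : ℕ} {f : EuclideanSpace ℝ (Fin n) → ℝ}
    {x : EuclideanSpace ℝ (Fin n)} {i : Fin n} {η : ℝ}
    (hf : DifferentiableAt ℝ f (x + η • EuclideanSpace.single i 1)) :
    HasDerivAt (fun s : ℝ => f (x + s • EuclideanSpace.single i 1))
      (pderiv' i f (x + η • EuclideanSpace.single i 1)) η := by
  have h : HasDerivAt (fun s : ℝ => x + s • EuclideanSpace.single i (1 : ℝ))
      (EuclideanSpace.single i 1) η := by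
    simpa using ((hasDerivAt_id η).smul_const (EuclideanSpace.single i (1 : ℝ))).const_add x
  exact hf.hasFDerivAt.comp_hasDerivAt η h

theorem contDiffOn_pderiv' {n : ℕ} {Ω : Set (EuclideanSpace ℝ (Fin n))} (hΩ : IsOpen Ω)
    {f : EuclideanSpace ℝ (Fin n) → ℝ} {k m : WithTop ℕ∞} (hf : ContDiffOn ℝ k f Ω)
    (hmk : m + 1 ≤ k) (i : Fin n) : ContDiffOn ℝ m (pderiv' i f) Ω :=
  (hf.fderiv_of_isOpen hΩ hmk).clm_apply contDiffOn_const

theorem fderiv_apply_eq_sum_pderiv' {n : ℕ} (f : EuclideanSpace ℝ (Fin n) → ℝ)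
    (x v : EuclideanSpace ℝ (Fin n)) : fderiv ℝ f x v = ∑ i, v i * pderiv' i f x := by
  conv_lhs => rw [← (EuclideanSpace.basisFun (Fin n) ℝ).sum_repr v]
  simp [pderiv', map_sum]

theorem ExtendsCont.continuousOn {n : ℕ} {Ω : Set (EuclideanSpace ℝ (Fin n))} {T : ℝ}
    {f : EuclideanSpace ℝ (Fin n) → ℝ → ℝ} (h : ExtendsCont Ω T f) :
    ContinuousOn (fun z : EuclideanSpace ℝ (Fin n) × ℝ => f z.1 z.2) (Ω ×ˢ Icc 0 T) := by
  obtain ⟨g, hg, hgf⟩ := h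
  exact (hg.mono (prod_mono_left subset_closure)).congr fun z hz => (hgf z.1 hz.1 z.2 hz.2).symm

/-- Time derivatives commute with spatial partial derivatives. -/
theorem hasDerivWithinAt_pderiv' {n : ℕ} {Ω : Set (EuclideanSpace ℝ (Fin n))} (hΩ : IsOpen Ω)
    {T : ℝ} {f ft : EuclideanSpace ℝ (Fin n) → ℝ → ℝ} {i : Fin n}
    (hf : ∀ t ∈ Icc (0 : ℝ) T, DifferentiableOn ℝ (fun y => f y t) Ω)
    (hft : ∀ t ∈ Icc (0 : ℝ) T, DifferentiableOn ℝ (fun y => ft y t) Ω)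
    (hderiv : ∀ x ∈ Ω, ∀ t ∈ Icc (0 : ℝ) T, HasDerivWithinAt (f x) (ft x t) (Icc 0 T) t)
    (hext : ExtendsCont Ω T fun x t => pderiv' i (fun y => ft y t) x)
    {x : EuclideanSpace ℝ (Fin n)} (hx : x ∈ Ω) {t : ℝ} (ht : t ∈ Icc (0 : ℝ) T) :
    HasDerivWithinAt (fun s => pderiv' i (fun y => f y s) x)
      (pderiv' i (fun y => ft y t) x) (Icc 0 T) t := by
  have hcont : Continuous fun η : ℝ => x + η • EuclideanSpace.single i (1 : ℝ) := by fun_prop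
  obtain ⟨r, hr, hball⟩ := Metric.isOpen_iff.1 (hΩ.preimage hcont) 0 (by simpa using hx)
  have hmem : ∀ η ∈ Metric.ball (0 : ℝ) r, x + η • EuclideanSpace.single i (1 : ℝ) ∈ Ω :=
    fun η hη => hball hη
  have key := hasDerivWithinAt_param_deriv (S := Icc 0 T) (t := t) (r := r)
    (F := fun η s => f (x + η • EuclideanSpace.single i 1) s)
    (Fs := fun η s => ft (x + η • EuclideanSpace.single i 1) s)
    (Fsη := fun η s => pderiv' i (fun y => ft y s) (x + η • EuclideanSpace.single i 1))
    (Fη := fun s => pderiv' i (fun y => f y s) (x + (0 : ℝ) • EuclideanSpace.single i 1))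
    hr (convex_Icc 0 T) ht
    (fun η hη s hs => hderiv _ (hmem η hη) s hs)
    (fun s hs => hasDerivAt_comp_line (f := fun y => f y s)
      ((hf s hs).differentiableAt (hΩ.mem_nhds (hmem 0 (Metric.mem_ball_self hr)))))
    (fun s hs η hη => hasDerivAt_comp_line (f := fun y => ft y s)
      ((hft s hs).differentiableAt (hΩ.mem_nhds (hmem η hη)))) ?_
  · simpa using key
  · have h1 : ContinuousOn (fun q : ℝ × ℝ =>
        ((x + q.1 • EuclideanSpace.single i (1 : ℝ), q.2) : EuclideanSpace ℝ (Fin n) × ℝ))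
        (Metric.ball 0 r ×ˢ Icc 0 T) := by fun_prop
    exact (hext.continuousOn.comp h1 fun q hq => ⟨hmem q.1 hq.1, hq.2⟩) (0, t)
      ⟨Metric.mem_ball_self hr, ht⟩

theorem C32.hasDerivWithinAt_lap {n : ℕ} {Ω : Set (EuclideanSpace ℝ (Fin n))} (hΩ : IsOpen Ω)
    {T : ℝ} {u ut utt : EuclideanSpace ℝ (Fin n) → ℝ → ℝ} (h : C32 Ω T u ut utt)
    {x : EuclideanSpace ℝ (Fin n)} (hx : x ∈ Ω) {t : ℝ} (ht : t ∈ Icc (0 : ℝ) T) :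
    HasDerivWithinAt (fun s => lap (fun y => u y s) x) (lap (fun y => ut y t) x) (Icc 0 T) t := by
  obtain ⟨hu, hut, hd, -, -, -, -, -, -, -, he1, he2⟩ := h
  refine HasDerivWithinAt.fun_sum fun i _ => ?_
  refine hasDerivWithinAt_pderiv' hΩ (f := fun y s => pderiv' i (fun z => u z s) y)
    (ft := fun y s => pderiv' i (fun z => ut z s) y)
    (fun s hs => (contDiffOn_pderiv' hΩ (hu s hs) (m := 1) (by norm_num) i).differentiableOn
      one_ne_zero)
    (fun s hs => (contDiffOn_pderiv' hΩ (hut s hs) (m := 1) (by norm_num) i).differentiableOn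
      one_ne_zero)
    (fun y hy s hs => ?_) (he2 i i) hx ht
  exact hasDerivWithinAt_pderiv' hΩ
    (fun s hs => (hu s hs).differentiableOn (by norm_num))
    (fun s hs => (hut s hs).differentiableOn (by norm_num)) hd (he1 i) hy hs

/-- A function vanishing on the lateral boundary has vanishing time derivative there. -/
theorem time_deriv_eq_zero_of_mem_frontier {n : ℕ} {Ω : Set (EuclideanSpace ℝ (Fin n))} {T : ℝ}
    (hT : 0 < T) {u ut : EuclideanSpace ℝ (Fin n) → ℝ → ℝ}
    (hd : ∀ x ∈ Ω, ∀ t ∈ Icc (0 : ℝ) T, HasDerivWithinAt (u x) (ut x t) (Icc 0 T) t)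
    (hu : ContinuousOn (fun z : EuclideanSpace ℝ (Fin n) × ℝ => u z.1 z.2)
      (closure Ω ×ˢ Icc 0 T))
    (hut : ContinuousOn (fun z : EuclideanSpace ℝ (Fin n) × ℝ => ut z.1 z.2)
      (closure Ω ×ˢ Icc 0 T))
    (h0 : ∀ x ∈ frontier Ω, ∀ t ∈ Icc (0 : ℝ) T, u x t = 0)
    {x : EuclideanSpace ℝ (Fin n)} (hx : x ∈ frontier Ω) {t : ℝ} (ht : t ∈ Icc (0 : ℝ) T) :
    ut x t = 0 := by
  by_contra hne
  set c := ut x t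
  have hc : 0 < ‖c‖ := norm_pos_iff.2 hne
  have hxc : x ∈ closure Ω := frontier_subset_closure hx
  obtain ⟨δ, hδ, hδ'⟩ := Metric.continuousWithinAt_iff.1 (hut (x, t) ⟨hxc, ht⟩) (‖c‖ / 2)
    (by positivity)
  obtain ⟨s, hs, hst, hsδ⟩ : ∃ s ∈ Icc (0 : ℝ) T, s ≠ t ∧ dist s t < δ := by
    rcases lt_or_ge t T with h | h
    · refine ⟨min T (t + δ / 2), ⟨?_, min_le_left _ _⟩, ?_, ?_⟩
      · exact le_min hT.le (by linarith [ht.1])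
      · exact (lt_min h (by linarith)).ne'
      · have h1 : t < min T (t + δ / 2) := lt_min h (by linarith)
        have h2 := min_le_right T (t + δ / 2)
        rw [Real.dist_eq, abs_of_pos (by linarith)]
        linarith
    · refine ⟨max 0 (t - δ / 2), ⟨le_max_left _ _, ?_⟩, ?_, ?_⟩
      · exact max_le hT.le (by linarith [ht.2])
      · exact (max_lt (by linarith) (by linarith)).ne
      · have h1 : max 0 (t - δ / 2) < t := max_lt (by linarith) (by linarith)
        have h2 := le_max_right 0 (t - δ / 2)
        rw [Real.dist_eq, abs_of_neg (by linarith)]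
        linarith
  have hbound : ∀ y ∈ Ω ∩ Metric.ball x δ,
      ‖u y s - u y t - (s - t) * c‖ ≤ ‖c‖ / 2 * ‖s - t‖ := by
    intro y hy
    have := ((convex_Icc 0 T).inter (convex_ball t δ)).norm_image_sub_le_of_norm_hasDerivWithin_le
      (f := fun s => u y s - s * c) (f' := fun s => ut y s - 1 * c) (C := ‖c‖ / 2)
      (x := t) (y := s)
      (fun ξ hξ => (((hd y hy.1 ξ hξ.1)).mono inter_subset_left).sub
        ((hasDerivWithinAt_id ξ _).mul_const _))
      (fun ξ hξ => by
        rw [one_mul]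
        refine (hδ' (x := (y, ξ)) ⟨subset_closure hy.1, hξ.1⟩ ?_).le
        rw [Prod.dist_eq]
        exact max_lt hy.2 hξ.2) ⟨ht, Metric.mem_ball_self hδ⟩ ⟨hs, hsδ⟩
    calc _ = _ := by congr 1; ring
      _ ≤ _ := this
  have hlim : ∀ r ∈ Icc (0 : ℝ) T, Filter.Tendsto (fun y => u y r) (nhdsWithin x Ω) (nhds 0) := by
    intro r hr
    have h1 : ContinuousOn (fun y => u y r) (closure Ω) :=
      hu.comp (f := fun y => (y, r)) (by fun_prop) fun y hy => ⟨hy, hr⟩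
    have h2 := (h1 x hxc).mono subset_closure
    rwa [ContinuousWithinAt, h0 x hx r hr] at h2
  have : (nhdsWithin x Ω).NeBot := mem_closure_iff_nhdsWithin_neBot.1 hxc
  have hle := le_of_tendsto ((((hlim s hs).sub (hlim t ht)).sub_const ((s - t) * c)).norm)
    (by filter_upwards [inter_mem_nhdsWithin Ω (Metric.ball_mem_nhds x hδ)] with y hy
        exact hbound y hy)
  have hst' : 0 < ‖s - t‖ := norm_pos_iff.2 (sub_ne_zero.2 hst)
  rw [sub_zero, zero_sub, norm_neg, norm_mul] at hle
  nlinarith [mul_pos hc hst']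

/-- Every point of an open set is joined to a nearest boundary point inside the set. -/
theorem exists_frontier_dist_eq_dB {n : ℕ} {Ω : Set (EuclideanSpace ℝ (Fin n))} (hΩ : IsOpen Ω)
    (hne : Ω ≠ univ) {x : EuclideanSpace ℝ (Fin n)} (hx : x ∈ Ω) :
    ∃ y ∈ frontier Ω, dist x y = dB Ω x ∧ Metric.ball x (dB Ω x) ⊆ Ω := by
  obtain ⟨y, hy, hxy⟩ := exists_mem_frontier_infDist_compl_eq_dist hx hne
  have hsub : frontier Ω ⊆ Ωᶜ := fun z hz hzΩ =>
    disjoint_left.1 (disjoint_frontier_iff_isOpen.2 hΩ) hz hzΩ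
  have h1 : dist x y = dB Ω x :=
    le_antisymm (hxy ▸ Metric.infDist_le_infDist_of_subset hsub ⟨y, hy⟩)
      (Metric.infDist_le_dist_of_mem hy)
  exact ⟨y, hy, h1, by rw [← h1, ← hxy]; exact Metric.ball_infDist_compl_subset⟩

/-- If `f` vanishes at a nearest boundary point and `f x ≥ c⁻¹ d(x)`, then the gradient of `f` is
bounded below somewhere on the segment from `x` to that point. -/
theorem exists_grad_lower_bound {n : ℕ} {Ω : Set (EuclideanSpace ℝ (Fin n))} (hΩ : IsOpen Ω)
    (hne : Ω ≠ univ) {f : EuclideanSpace ℝ (Fin n) → ℝ} (hf : DifferentiableOn ℝ f Ω)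
    (hfc : ContinuousOn f (closure Ω)) (hf0 : ∀ y ∈ frontier Ω, f y = 0) {c : ℝ} (hc : 0 < c)
    {x : EuclideanSpace ℝ (Fin n)} (hx : x ∈ Ω) (hfx : 0 < f x) (hlow : c⁻¹ * dB Ω x ≤ f x) :
    ∃ y ∈ Ω, dist y x ≤ dB Ω x ∧ (c ^ 2)⁻¹ ≤ ∑ i, pderiv' i f y ^ 2 := by
  obtain ⟨y, hy, hxy, hball⟩ := exists_frontier_dist_eq_dB hΩ hne hx
  have hd : 0 < dB Ω x := by
    rw [← hxy, dist_pos]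
    rintro rfl
    exact hfx.ne' (hf0 x hy)
  have hdist : ∀ s ∈ Icc (0 : ℝ) 1, dist (x + s • (y - x)) x = s * dB Ω x := by
    intro s hs
    rw [dist_eq_norm, add_sub_cancel_left, norm_smul, Real.norm_of_nonneg hs.1, ← dist_eq_norm,
      dist_comm y x, hxy]
  have hmem : ∀ s ∈ Ico (0 : ℝ) 1, x + s • (y - x) ∈ Ω := by
    intro s hs
    apply hball
    rw [Metric.mem_ball, hdist s ⟨hs.1, hs.2.le⟩]
    nlinarith [hs.2]
  have hmem' : ∀ s ∈ Icc (0 : ℝ) 1, x + s • (y - x) ∈ closure Ω := by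
    intro s hs
    rcases hs.2.lt_or_eq with h | rfl
    · exact subset_closure (hmem s ⟨hs.1, h⟩)
    · simpa using frontier_subset_closure hy
  obtain ⟨s, hs, hslope⟩ := exists_hasDerivAt_eq_slope (fun s : ℝ => f (x + s • (y - x)))
    (fun s => fderiv ℝ f (x + s • (y - x)) (y - x)) zero_lt_one
    (hfc.comp (by fun_prop) hmem')
    (fun s hs => by
      have h : HasDerivAt (fun s : ℝ => x + s • (y - x)) (y - x) s := by
        simpa using ((hasDerivAt_id s).smul_const (y - x)).const_add x
      exact (hf.differentiableAt
        (hΩ.mem_nhds (hmem s ⟨hs.1.le, hs.2⟩))).hasFDerivAt.comp_hasDerivAt s h)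
  have hs' : s ∈ Icc (0 : ℝ) 1 := ⟨hs.1.le, hs.2.le⟩
  refine ⟨x + s • (y - x), hmem s ⟨hs.1.le, hs.2⟩, ?_, ?_⟩
  · rw [hdist s hs']
    exact mul_le_of_le_one_left hd.le hs.2.le
  · simp only [one_smul, add_sub_cancel, hf0 y hy, zero_smul, add_zero, sub_zero, div_one,
      zero_sub, fderiv_apply_eq_sum_pderiv'] at hslope
    have hcs := Finset.sum_mul_sq_le_sq_mul_sq Finset.univ (fun i => (y - x) i)
      (fun i => pderiv' i f (x + s • (y - x)))
    rw [hslope, ← EuclideanSpace.real_norm_sq_eq, ← dist_eq_norm, dist_comm, hxy, neg_sq] at hcs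
    have h1 : (c⁻¹ * dB Ω x) ^ 2 ≤ f x ^ 2 := pow_le_pow_left₀ (by positivity) hlow 2
    rw [← inv_pow]
    have h2 : dB Ω x ^ 2 * c⁻¹ ^ 2 ≤
        dB Ω x ^ 2 * ∑ i, pderiv' i f (x + s • (y - x)) ^ 2 := by nlinarith
    exact le_of_mul_le_mul_left h2 (by positivity)

theorem FDSetting.ne_univ {n : ℕ} {Ω : Set (EuclideanSpace ℝ (Fin n))} {p b T c₀ : ℝ}
    {u ut utt : EuclideanSpace ℝ (Fin n) → ℝ → ℝ} (h : FDSetting Ω p b T c₀ u ut utt) :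
    Ω ≠ univ := by
  rintro rfl
  obtain ⟨-, -, -, hT, -, -, hpos, -, -, hcmp⟩ := h
  have h1 := hpos 0 (mem_univ _) 0 ⟨le_rfl, hT.le⟩
  have h2 := (hcmp 0 (mem_univ _) 0 ⟨le_rfl, hT.le⟩).2
  simp only [dB, frontier_univ, Metric.infDist_empty, mul_zero] at h2
  exact h1.not_ge h2

/-- The gradient of a solution is bounded below where the solution is small. -/
theorem FDSetting.exists_grad_lower_bound {n : ℕ} {Ω : Set (EuclideanSpace ℝ (Fin n))}
    {p b T c₀ : ℝ} {u ut utt : EuclideanSpace ℝ (Fin n) → ℝ → ℝ}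
    (h : FDSetting Ω p b T c₀ u ut utt) :
    ∃ δ, 0 < δ ∧ ∀ x ∈ Ω, ∀ t ∈ Icc (0 : ℝ) T, u x t < δ →
      (c₀ ^ 2)⁻¹ / 2 ≤ ∑ i, pderiv' i (fun y => u y t) x ^ 2 := by
  have hne := h.ne_univ
  obtain ⟨⟨hΩ, hΩb, -, -⟩, -, -, -, hc, hC, hpos, -, h0, hcmp⟩ := h
  obtain ⟨hu, -, -, -, huc, -, -, he, -⟩ := hC
  choose g hg hgu using he
  have hc0 : 0 < c₀ := by linarith
  have hcpt : IsCompact (closure Ω ×ˢ Icc (0 : ℝ) T) := hΩb.isCompact_closure.prod isCompact_Icc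
  have hunif := hcpt.uniformContinuousOn_of_continuous
    (f := fun z : EuclideanSpace ℝ (Fin n) × ℝ => ∑ i, g i z.1 z.2 ^ 2)
    (continuousOn_finsetSum _ fun i _ => (hg i).pow 2)
  obtain ⟨η, hη, hη'⟩ := Metric.uniformContinuousOn_iff.1 hunif ((c₀ ^ 2)⁻¹ / 2) (by positivity)
  refine ⟨c₀⁻¹ * η, by positivity, fun x hx t ht hxt => ?_⟩
  obtain ⟨y, hy, hyx, hgy⟩ := _root_.exists_grad_lower_bound hΩ hne
    ((hu t ht).differentiableOn (by norm_num))
    (huc.comp (f := fun y => (y, t)) (by fun_prop) fun y hy => ⟨hy, ht⟩)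
    (fun y hy => h0 y hy t ht) hc0 hx (hpos x hx t ht) (hcmp x hx t ht).1
  have hdη : dB Ω x < η :=
    lt_of_mul_lt_mul_left ((hcmp x hx t ht).1.trans_lt hxt) (by positivity)
  have hd := hη' (y, t) ⟨subset_closure hy, ht⟩ (x, t) ⟨subset_closure hx, ht⟩ (by
    rw [Prod.dist_eq]
    exact max_lt (hyx.trans_lt hdη) (by simpa using hη))
  simp only [hgu _ y hy t ht, hgu _ x hx t ht] at hd
  rw [Real.dist_eq, abs_lt] at hd
  linarith [hd.2]

/-- Second derivative test for the comparison function built from `U` and `Z`. -/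
theorem lap_comparison_nonpos {n : ℕ} {Ω : Set (EuclideanSpace ℝ (Fin n))} (hΩ : IsOpen Ω)
    {U Z : EuclideanSpace ℝ (Fin n) → ℝ} (hU : ContDiffOn ℝ 2 U Ω) (hZ : ContDiffOn ℝ 2 Z Ω)
    {x : EuclideanSpace ℝ (Fin n)} (hx : x ∈ Ω) {t a E A B : ℝ}
    (hmax : IsLocalMax (fun y => t * Z y - a * U y - E * (1 + B * U y - A * U y ^ 2)) x) :
    t * lap Z x - a * lap U x
      - E * (B * lap U x - 2 * A * (∑ i, pderiv' i U x ^ 2 + U x * lap U x)) ≤ 0 := by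
  have key : ∀ i, t * pderiv' i (pderiv' i Z) x - a * pderiv' i (pderiv' i U) x
      - E * (B * pderiv' i (pderiv' i U) x - 2 * A * (pderiv' i U x ^ 2
        + U x * pderiv' i (pderiv' i U) x)) ≤ 0 := by
    intro i
    have hcont : Continuous fun η : ℝ => x + η • EuclideanSpace.single i (1 : ℝ) := by fun_prop
    have hx0 : x + (0 : ℝ) • EuclideanSpace.single i (1 : ℝ) = x := by simp
    have hev : ∀ᶠ η : ℝ in nhds 0, x + η • EuclideanSpace.single i (1 : ℝ) ∈ Ω :=
      (hΩ.preimage hcont).mem_nhds (by simpa using hx)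
    have hd : ∀ {f}, ContDiffOn ℝ 2 f Ω → ∀ η : ℝ,
        x + η • EuclideanSpace.single i (1 : ℝ) ∈ Ω →
        HasDerivAt (fun s : ℝ => f (x + s • EuclideanSpace.single i 1))
          (pderiv' i f (x + η • EuclideanSpace.single i 1)) η := fun hf η hη =>
      hasDerivAt_comp_line ((hf.differentiableOn (by norm_num)).differentiableAt (hΩ.mem_nhds hη))
    have hdd : ∀ {f}, ContDiffOn ℝ 2 f Ω →
        HasDerivAt (fun s : ℝ => pderiv' i f (x + s • EuclideanSpace.single i 1))
          (pderiv' i (pderiv' i f) x) 0 := by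
      intro f hf
      have := hasDerivAt_comp_line (f := pderiv' i f) (x := x) (i := i) (η := 0)
        (((contDiffOn_pderiv' hΩ hf (m := 1) (by norm_num) i).differentiableOn
          one_ne_zero).differentiableAt (hΩ.mem_nhds (by rwa [hx0])))
      rwa [hx0] at this
    have hU0 := hd hU 0 (by rwa [hx0])
    have h2 := second_deriv_nonpos_of_isLocalMax (s := 0)
      (g := fun s : ℝ => t * Z (x + s • EuclideanSpace.single i 1)
        - a * U (x + s • EuclideanSpace.single i 1)
        - E * (1 + B * U (x + s • EuclideanSpace.single i 1)
          - A * U (x + s • EuclideanSpace.single i 1) ^ 2))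
      (g' := fun s : ℝ => t * pderiv' i Z (x + s • EuclideanSpace.single i 1)
        - a * pderiv' i U (x + s • EuclideanSpace.single i 1)
        - E * (B * pderiv' i U (x + s • EuclideanSpace.single i 1)
          - A * (2 * (U (x + s • EuclideanSpace.single i 1)
            * pderiv' i U (x + s • EuclideanSpace.single i 1)))))
      (by
        filter_upwards [hev] with η hη
        have h1 := hd hU η hη
        refine ((((hd hZ η hη).const_mul t).sub (h1.const_mul a)).sub
          ((((h1.const_mul B).const_add 1).sub ((h1.fun_pow 2).const_mul A)).const_mul
            E)).congr_deriv ?_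
        push_cast
        ring)
      ((((hdd hZ).const_mul t).sub ((hdd hU).const_mul a)).sub
          ((((hdd hU).const_mul B).sub (((hU0.mul (hdd hU)).const_mul 2).const_mul A)).const_mul
            E))
      (by
        have h3 : Filter.Tendsto (fun η : ℝ => x + η • EuclideanSpace.single i (1 : ℝ)) (nhds 0)
            (nhds x) := by simpa using hcont.tendsto 0
        filter_upwards [h3.eventually hmax] with η hη
        simpa using hη)
    simp only [hx0] at h2
    linarith
  have := Finset.sum_nonpos fun i (_ : i ∈ Finset.univ) => key i
  simp only [Finset.sum_sub_distrib, ← Finset.mul_sum, Finset.sum_add_distrib] at this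
  exact this

/-- The equation, and the equation differentiated in time, in expanded form. -/
theorem FDSetting.expanded_equations {n : ℕ} {Ω : Set (EuclideanSpace ℝ (Fin n))}
    {p b T c₀ : ℝ} {u ut utt : EuclideanSpace ℝ (Fin n) → ℝ → ℝ}
    (h : FDSetting Ω p b T c₀ u ut utt) {x : EuclideanSpace ℝ (Fin n)} (hx : x ∈ Ω) {t : ℝ}
    (ht : t ∈ Ioc (0 : ℝ) T) :
    p * (u x t ^ (p - 2) * u x t) * ut x t
      = lap (fun y => u y t) x + b * u x t + u x t ^ (p - 2) * u x t ^ 2 ∧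
    p * ((p - 1) * u x t ^ (p - 2) * ut x t * ut x t + u x t ^ (p - 2) * u x t * utt x t)
      = lap (fun y => ut y t) x + b * ut x t + p * (u x t ^ (p - 2) * u x t) * ut x t := by
  obtain ⟨⟨hΩ, -⟩, hp, -, hT, -, hC, hpos, heq, -, -⟩ := h
  have ht' : t ∈ Icc (0 : ℝ) T := ⟨ht.1.le, ht.2⟩
  have huniq : ∀ s ∈ Icc (0 : ℝ) T, UniqueDiffWithinAt ℝ (Icc 0 T) s :=
    fun s hs => uniqueDiffOn_Icc hT s hs
  have hlap := hC.hasDerivWithinAt_lap hΩ hx ht'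
  obtain ⟨-, -, hd, hdd, -⟩ := hC
  have hup := hpos x hx t ht'
  have hpow1 : u x t ^ (p - 1) = u x t ^ (p - 2) * u x t := by
    rw [← Real.rpow_add_one hup.ne']; ring_nf
  have hpow2 : u x t ^ p = u x t ^ (p - 2) * u x t ^ 2 := by
    rw [← Real.rpow_add_natCast hup.ne']; norm_num
  have heqn : ∀ s ∈ Ioc (0 : ℝ) T, ut x s * p * u x s ^ (p - 1)
      = lap (fun y => u y s) x + b * u x s + u x s ^ p := by
    intro s hs
    have hs' : s ∈ Icc (0 : ℝ) T := ⟨hs.1.le, hs.2⟩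
    exact (huniq s hs').eq_deriv _
      ((hd x hx s hs').rpow_const (Or.inl (hpos x hx s hs').ne')) (heq x hx s hs)
  have heqt := heqn t ht
  refine ⟨by rw [hpow1, hpow2] at heqt; linarith, ?_⟩
  have hL := ((hdd x hx t ht').mul_const p).mul
    ((hd x hx t ht').rpow_const (p := p - 1) (Or.inl hup.ne'))
  have hR := (hlap.add ((hd x hx t ht').const_mul b)).add
    ((hd x hx t ht').rpow_const (p := p) (Or.inl hup.ne'))
  have hEq : (fun s => ut x s * p * u x s ^ (p - 1)) =ᶠ[nhdsWithin t (Icc 0 T)]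
      fun s => lap (fun y => u y s) x + b * u x s + u x s ^ p := by
    filter_upwards [self_mem_nhdsWithin, mem_nhdsWithin_of_mem_nhds (Ioi_mem_nhds ht.1)] with s hs hs0
    exact heqn s ⟨hs0, hs.2⟩
  have hfin := (huniq t ht').eq_deriv _ (hL.congr_of_eventuallyEq hEq.symm (heqt.symm)) hR
  rw [show p - 1 - 1 = p - 2 by ring, hpow1] at hfin
  linarith

/-- Comparison principle: under the barrier inequality, `t ∂ₜu` stays strictly below
`(t / p + 1 / (p - 1)) u` plus the barrier. -/
theorem FDSetting.comparison_neg {n : ℕ} {Ω : Set (EuclideanSpace ℝ (Fin n))}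
    {p b T c₀ : ℝ} {u ut utt : EuclideanSpace ℝ (Fin n) → ℝ → ℝ}
    (h : FDSetting Ω p b T c₀ u ut utt) {ε A B K : ℝ} (hε : 0 < ε)
    (hh : ∀ x ∈ Ω, ∀ t ∈ Icc (0 : ℝ) T, 0 < 1 + B * u x t - A * u x t ^ 2)
    (hbar : ∀ x ∈ Ω, ∀ t ∈ Ioc (0 : ℝ) T,
      b * (1 + A * u x t ^ 2)
        + u x t ^ (p - 2) * u x t * (1 + B * u x t - A * u x t ^ 2) * (1 - p * K)
        - (B - 2 * A * u x t) * (u x t ^ (p - 2) * u x t ^ 2)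
        - 2 * A * ∑ i, pderiv' i (fun y => u y t) x ^ 2 < 0)
    {x : EuclideanSpace ℝ (Fin n)} (hx : x ∈ Ω) {t : ℝ} (ht : t ∈ Icc (0 : ℝ) T) :
    t * ut x t - (t / p + 1 / (p - 1)) * u x t
      - ε * Real.exp (K * t) * (1 + B * u x t - A * u x t ^ 2) < 0 := by
  by_contra! hcon
  have heqs := @FDSetting.expanded_equations _ _ _ _ _ _ _ _ _ h
  obtain ⟨⟨hΩ, hΩb, -, -⟩, hp, -, hT, -, hC, hpos, -, h0, -⟩ := h
  obtain ⟨hu3, hut2, hd, hdd, huc, hutc, -⟩ := hC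
  set G : EuclideanSpace ℝ (Fin n) × ℝ → ℝ := fun z =>
    z.2 * ut z.1 z.2 - (z.2 / p + 1 / (p - 1)) * u z.1 z.2
      - ε * Real.exp (K * z.2) * (1 + B * u z.1 z.2 - A * u z.1 z.2 ^ 2) with hGdef
  have hG : ContinuousOn G (closure Ω ×ˢ Icc (0 : ℝ) T) := by
    have e1 : ContinuousOn (fun z : EuclideanSpace ℝ (Fin n) × ℝ => z.2)
      (closure Ω ×ˢ Icc (0 : ℝ) T) := continuousOn_snd
    have e2 : ContinuousOn (fun z : EuclideanSpace ℝ (Fin n) × ℝ => Real.exp (K * z.2))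
      (closure Ω ×ˢ Icc (0 : ℝ) T) := by fun_prop
    exact ((e1.mul hutc).sub (((e1.div_const p).add continuousOn_const).mul huc)).sub
      ((continuousOn_const.mul e2).mul ((continuousOn_const.add (continuousOn_const.mul huc)).sub
        (continuousOn_const.mul (huc.pow 2))))
  have hcpt : IsCompact (closure Ω ×ˢ Icc (0 : ℝ) T) := hΩb.isCompact_closure.prod isCompact_Icc
  have hS : IsCompact ((closure Ω ×ˢ Icc (0 : ℝ) T) ∩ G ⁻¹' Ici 0) :=
    hcpt.of_isClosed_subset (hG.preimage_isClosed_of_isClosed hcpt.isClosed isClosed_Ici)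
      inter_subset_left
  obtain ⟨⟨x₀, t₀⟩, ⟨⟨hx₀, ht₀⟩, hG₀⟩, hmin⟩ :=
    hS.exists_isMinOn ⟨(x, t), ⟨subset_closure hx, ht⟩, hcon⟩ continuousOn_snd
  simp only [mem_preimage, mem_Ici] at hG₀ hx₀ ht₀
  have hbefore : ∀ y ∈ closure Ω, ∀ s ∈ Ico 0 t₀, G (y, s) < 0 := by
    intro y hy s hs
    by_contra! hys
    exact hs.2.not_ge (hmin ⟨⟨hy, hs.1, hs.2.le.trans ht₀.2⟩, hys⟩)
  have hp1 : 0 < p - 1 := by linarith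
  have hx₀Ω : x₀ ∈ Ω := by
    by_contra hn
    have hfr : x₀ ∈ frontier Ω := by rw [hΩ.frontier_eq]; exact ⟨hx₀, hn⟩
    have e1 := time_deriv_eq_zero_of_mem_frontier hT hd huc hutc h0 hfr ht₀
    simp only [hGdef, e1, h0 x₀ hfr t₀ ht₀] at hG₀
    have := mul_pos hε (Real.exp_pos (K * t₀))
    norm_num at hG₀
    linarith
  have hup := hpos x₀ hx₀Ω t₀ ht₀
  have ht₀pos : 0 < t₀ := by
    refine ht₀.1.lt_of_ne fun h00 => ?_
    subst h00
    have e1 := mul_pos (mul_pos hε (Real.exp_pos (K * 0))) (hh x₀ hx₀Ω 0 ht₀)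
    have e2 : 0 < (0 / p + 1 / (p - 1)) * u x₀ 0 := by rw [zero_div, zero_add]; positivity
    simp only [hGdef] at hG₀
    linarith
  have hle : ∀ y ∈ closure Ω, G (y, t₀) ≤ 0 := by
    intro y hy
    have h1 : ContinuousOn (fun s => G (y, s)) (Icc 0 T) :=
      hG.comp (by fun_prop) fun s hs => ⟨hy, hs⟩
    have h2 := (h1 t₀ ht₀).mono fun s (hs : s ∈ Ico 0 t₀) => ⟨hs.1, hs.2.le.trans ht₀.2⟩
    have : (nhdsWithin t₀ (Ico 0 t₀)).NeBot := by
      rw [← mem_closure_iff_nhdsWithin_neBot, closure_Ico ht₀pos.ne]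
      exact ⟨ht₀.1, le_rfl⟩
    exact le_of_tendsto h2 (by
      filter_upwards [self_mem_nhdsWithin] with s hs using (hbefore y hy s hs).le)
  have hzero : G (x₀, t₀) = 0 := le_antisymm (hle x₀ hx₀) hG₀
  have hexp := mul_pos hε (Real.exp_pos (K * t₀))
  have hlap := lap_comparison_nonpos hΩ ((hu3 t₀ ht₀).of_le (by norm_num)) (hut2 t₀ ht₀) hx₀Ω
    (t := t₀) (a := t₀ / p + 1 / (p - 1)) (E := ε * Real.exp (K * t₀)) (A := A) (B := B) (by
      filter_upwards [hΩ.mem_nhds hx₀Ω] with y hy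
      exact (hle y (subset_closure hy)).trans_eq hzero.symm)
  have hdu := hd x₀ hx₀Ω t₀ ht₀
  have hid := hasDerivWithinAt_id t₀ (Icc (0 : ℝ) T)
  have htime := deriv_nonneg_of_forall_le_left (g := fun s => G (x₀, s)) ht₀pos ht₀.2
    (((hid.mul (hdd x₀ hx₀Ω t₀ ht₀)).sub (((hid.div_const p).add_const (1 / (p - 1))).mul hdu)).sub
      ((((hid.const_mul K).exp).const_mul ε).mul
        (((hdu.const_mul B).const_add 1).sub ((hdu.fun_pow 2).const_mul A))))
    fun s hs => ((hbefore x₀ hx₀ s hs).trans_eq hzero.symm).le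
  obtain ⟨h1, h2⟩ := heqs hx₀Ω ⟨ht₀pos, ht₀.2⟩
  refine touching_point_algebra (K := K) hp ht₀pos hup (Real.rpow_pos_of_pos hup (p - 2)) hexp
    (hh x₀ hx₀Ω t₀ ht₀) rfl h1 h2 hzero ?_ hlap (hbar x₀ hx₀Ω t₀ ⟨ht₀pos, ht₀.2⟩)
  refine htime.trans_eq ?_
  simp only [id]
  push_cast
  ring

/-- The Aronson–Bénilan type estimate `t ∂ₜu ≤ (t / p + 1 / (p - 1)) u`. -/
theorem FDSetting.mul_time_deriv_le {n : ℕ} {Ω : Set (EuclideanSpace ℝ (Fin n))}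
    {p b T c₀ : ℝ} {u ut utt : EuclideanSpace ℝ (Fin n) → ℝ → ℝ}
    (h : FDSetting Ω p b T c₀ u ut utt)
    {x : EuclideanSpace ℝ (Fin n)} (hx : x ∈ Ω) {t : ℝ} (ht : t ∈ Icc (0 : ℝ) T) :
    t * ut x t ≤ (t / p + 1 / (p - 1)) * u x t := by
  obtain ⟨δ₁, hδ₁, hgrad⟩ := h.exists_grad_lower_bound
  have hcomp := @FDSetting.comparison_neg _ _ _ _ _ _ _ _ _ h
  obtain ⟨⟨hΩ, hΩb, -, -⟩, hp, -, hT, hc, hC, hpos, -, -, -⟩ := h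
  obtain ⟨-, -, -, -, huc, -⟩ := hC
  have hc0 : 0 < c₀ := by linarith
  obtain ⟨M, hM⟩ :=
    (hΩb.isCompact_closure.prod (isCompact_Icc (a := (0 : ℝ)) (b := T))).bddAbove_image huc
  have hM' : ∀ y ∈ Ω, ∀ s ∈ Icc (0 : ℝ) T, u y s ≤ M := fun y hy s hs =>
    hM ⟨(y, s), ⟨subset_closure hy, hs⟩, rfl⟩
  have hM0 : 0 < M := (hpos x hx t ht).trans_le (hM' x hx t ht)
  set A := c₀ ^ 2 * (|b| + 1) with hA
  have hA0 : 0 < A := by positivity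
  set B := 2 * A * M
  set δ := min δ₁ (min 1 (1 / (|b| * A + 1)))
  have hδ : 0 < δ := by positivity
  set K := ((|b| * (1 + A * M ^ 2) + 1) / δ ^ (p - 1) + 1) / p with hK
  have hpK : p * K - 1 = (|b| * (1 + A * M ^ 2) + 1) / δ ^ (p - 1) := by
    rw [hK]; field_simp; ring
  have hδp : 0 < δ ^ (p - 1) := Real.rpow_pos_of_pos hδ _
  have hpK0 : 0 < p * K - 1 := by rw [hpK]; positivity
  have hh : ∀ y ∈ Ω, ∀ s ∈ Icc (0 : ℝ) T, 1 ≤ 1 + B * u y s - A * u y s ^ 2 := by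
    intro y hy s hs
    have e1 := hpos y hy s hs
    have e2 := hM' y hy s hs
    have : 0 ≤ A * u y s * (2 * M - u y s) := by
      have : 0 ≤ 2 * M - u y s := by linarith
      positivity
    have e3 : B * u y s - A * u y s ^ 2 = A * u y s * (2 * M - u y s) := by ring
    linarith
  have hbar : ∀ y ∈ Ω, ∀ s ∈ Ioc (0 : ℝ) T,
      b * (1 + A * u y s ^ 2)
        + u y s ^ (p - 2) * u y s * (1 + B * u y s - A * u y s ^ 2) * (1 - p * K)
        - (B - 2 * A * u y s) * (u y s ^ (p - 2) * u y s ^ 2)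
        - 2 * A * ∑ i, pderiv' i (fun z => u z s) y ^ 2 < 0 := by
    intro y hy s hs
    have hs' : s ∈ Icc (0 : ℝ) T := ⟨hs.1.le, hs.2⟩
    have e1 := hpos y hy s hs'
    have e2 := hM' y hy s hs'
    have e3 := hh y hy s hs'
    have e4 : 0 < u y s ^ (p - 2) := Real.rpow_pos_of_pos e1 _
    have e5 : u y s ^ (p - 1) = u y s ^ (p - 2) * u y s := by
      rw [← Real.rpow_add_one e1.ne']; ring_nf
    have t3 : 0 ≤ (B - 2 * A * u y s) * (u y s ^ (p - 2) * u y s ^ 2) := by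
      have : B - 2 * A * u y s = 2 * A * (M - u y s) := by ring
      rw [this]
      have : 0 ≤ M - u y s := by linarith
      positivity
    have t1 : b * (1 + A * u y s ^ 2) ≤ |b| * (1 + A * u y s ^ 2) :=
      mul_le_mul_of_nonneg_right (le_abs_self b) (by positivity)
    have hN : 0 ≤ ∑ i, pderiv' i (fun z => u z s) y ^ 2 :=
      Finset.sum_nonneg fun i _ => sq_nonneg _
    rcases lt_or_ge (u y s) δ with hsmall | hlarge
    · have t2 : 0 ≤ u y s ^ (p - 2) * u y s * (1 + B * u y s - A * u y s ^ 2) * (p * K - 1) := by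
        have : 0 ≤ 1 + B * u y s - A * u y s ^ 2 := by linarith
        positivity
      have hg := hgrad y hy s hs' (hsmall.trans_le (min_le_left _ _))
      have t4 : |b| + 1 ≤ 2 * A * ∑ i, pderiv' i (fun z => u z s) y ^ 2 := by
        have := mul_le_mul_of_nonneg_left hg (by positivity : 0 ≤ 2 * A)
        have e : 2 * A * ((c₀ ^ 2)⁻¹ / 2) = |b| + 1 := by rw [hA]; field_simp
        linarith
      have u1 : u y s < 1 := hsmall.trans_le ((min_le_right _ _).trans (min_le_left _ _))
      have u2 : u y s < 1 / (|b| * A + 1) :=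
        hsmall.trans_le ((min_le_right _ _).trans (min_le_right _ _))
      rw [lt_div_iff₀ (by positivity)] at u2
      have u3 : |b| * (A * u y s ^ 2) ≤ |b| * A * u y s := by
        have : u y s ^ 2 ≤ u y s := by nlinarith
        nlinarith [mul_nonneg (abs_nonneg b) hA0.le]
      linarith
    · have t2 : |b| * (1 + A * M ^ 2) + 1 ≤
          u y s ^ (p - 2) * u y s * (1 + B * u y s - A * u y s ^ 2) * (p * K - 1) := by
        have k1 : δ ^ (p - 1) ≤ u y s ^ (p - 2) * u y s := by
          rw [← e5]; exact Real.rpow_le_rpow hδ.le hlarge (by linarith)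
        have k2 : δ ^ (p - 1) * 1 ≤
            u y s ^ (p - 2) * u y s * (1 + B * u y s - A * u y s ^ 2) :=
          mul_le_mul k1 e3 zero_le_one (by positivity)
        calc _ = δ ^ (p - 1) * 1 * (p * K - 1) := by rw [hpK]; field_simp
          _ ≤ _ := mul_le_mul_of_nonneg_right k2 hpK0.le
      have t4 : |b| * (1 + A * u y s ^ 2) ≤ |b| * (1 + A * M ^ 2) := by gcongr
      have t5 := mul_nonneg (by positivity : 0 ≤ 2 * A) hN
      linarith
  have hfin : ∀ ε > 0, t * ut x t ≤ (t / p + 1 / (p - 1)) * u x t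
      + ε * (Real.exp (K * t) * (1 + B * u x t - A * u x t ^ 2)) := by
    intro ε hε
    have := hcomp hε (fun y hy s hs => zero_lt_one.trans_le (hh y hy s hs)) hbar hx ht
    linarith
  set H := Real.exp (K * t) * (1 + B * u x t - A * u x t ^ 2)
  have hH : 0 < H := mul_pos (Real.exp_pos _) (zero_lt_one.trans_le (hh x hx t ht))
  refine le_of_forall_pos_le_add fun ε hε => ?_
  have := hfin (ε / H) (by positivity)
  rwa [div_mul_cancel₀ _ hH.ne'] at this

/-- Upper bound for the time derivative (Proposition 4.2 of the paper).  The constant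
depends only on `n`, `Ω`, `T`, `p`, `b`, `c₀` and (an upper bound `E` for)
`∫_Ω |∇u(·,0)|²`. -/
theorem stmt9 (n : ℕ) (hn : 1 ≤ n) (Ω : Set (EuclideanSpace ℝ (Fin n)))
    (p b c₀ T E : ℝ) :
    ∃ C : ℝ, 0 < C ∧
      ∀ (u ut utt : EuclideanSpace ℝ (Fin n) → ℝ → ℝ),
        FDSetting Ω p b T c₀ u ut utt →
        (∫ x in Ω, ‖gradient (fun y => u y 0) x‖ ^ 2) ≤ E →
        ∀ x ∈ closure Ω, ∀ t ∈ Set.Icc (T / 2) T, ut x t ≤ C := by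
  by_cases hex : ∃ u ut utt : EuclideanSpace ℝ (Fin n) → ℝ → ℝ, FDSetting Ω p b T c₀ u ut utt
  swap
  · exact ⟨1, one_pos, fun u ut utt h => (hex ⟨u, ut, utt, h⟩).elim⟩
  obtain ⟨-, -, -, ⟨-, hΩb, -⟩, hp, -, hT, hc, -⟩ := hex
  obtain ⟨D, hD⟩ := hΩb.isCompact_closure.bddAbove_image
    (Metric.continuous_infDist_pt (frontier Ω)).continuousOn
  have hD' : ∀ x ∈ Ω, dB Ω x ≤ D := fun x hx => hD ⟨x, subset_closure hx, rfl⟩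
  have hp1 : 0 < p - 1 := by linarith
  set C := (1 / p + 2 / T * (1 / (p - 1))) * (c₀ * D)
  refine ⟨max 1 C, by positivity, fun u ut utt h _ => ?_⟩
  have hT2 : ∀ t ∈ Icc (T / 2) T, t ∈ Icc (0 : ℝ) T := fun t ht => ⟨by linarith [ht.1], ht.2⟩
  have hΩle : ∀ x ∈ Ω, ∀ t ∈ Icc (T / 2) T, ut x t ≤ C := by
    intro x hx t ht
    have h1 := h.mul_time_deriv_le hx (hT2 t ht)
    obtain ⟨-, -, -, -, -, -, hpos, -, -, hcmp⟩ := h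
    have ht0 : 0 < t := by linarith [ht.1]
    have h2 : u x t ≤ c₀ * D := (hcmp x hx t (hT2 t ht)).2.trans
      (mul_le_mul_of_nonneg_left (hD' x hx) (by linarith))
    have h3 : ut x t ≤ (1 / p + 1 / t * (1 / (p - 1))) * u x t := by
      refine le_of_mul_le_mul_left (h1.trans_eq ?_) ht0
      field_simp
    have h4 : 1 / t ≤ 2 / T := by
      rw [div_le_div_iff₀ ht0 hT]
      linarith [ht.1]
    refine h3.trans (mul_le_mul ?_ h2 (hpos x hx t (hT2 t ht)).le (by positivity))
    gcongr
  intro x hx t ht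
  have hutc := h.2.2.2.2.2.1.2.2.2.2.2.1
  have hcont : ContinuousOn (fun y => ut y t) (closure Ω) :=
    hutc.comp (f := fun y => (y, t)) (by fun_prop) fun y hy => ⟨hy, hT2 t ht⟩
  have : (nhdsWithin x Ω).NeBot := mem_closure_iff_nhdsWithin_neBot.1 hx
  refine (le_of_tendsto ((hcont x hx).mono subset_closure) ?_).trans (le_max_right 1 C)
  filter_upwards [self_mem_nhdsWithin] with y hy using hΩle y hy t ht
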